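/- Let ρ_mix = (1/2)·I₂ be the maximally mixed qubit state and let L = |0⟩⟨1| (the 2×2 matrix with a single 1 in the upper-right entry) be the amplitude-damping Lindblad operator, with dissipator D(ρ) = LρL† − ½(L†Lρ + ρL†L). Then (i) ρ_mix satisfies the geometric stabilizability condition Tr(ρ_mix · D(ρ_mix)) = 0, but (ii) for every γ > 0 there exists no Hermitian 2×2 matrix H with −i(Hρ_mix − ρ_mix H) + γ D(ρ_mix) = 0; i.e., the maximally mixed state is not stabilizable under amplitude damping. -/

import Mathlib

open Matrix

theorem stmt_4
    (ρmix : Matrix (Fin 2) (Fin 2) ℂ)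
    (hρ : ρmix = (1/2 : ℂ) • (1 : Matrix (Fin 2) (Fin 2) ℂ))
    (L : Matrix (Fin 2) (Fin 2) ℂ) (hL : L = !![0, 1; 0, 0])
    (D : Matrix (Fin 2) (Fin 2) ℂ → Matrix (Fin 2) (Fin 2) ℂ)
    (hD : ∀ M, D M = L * M * Lᴴ - (1/2 : ℂ) • (Lᴴ * L * M + M * (Lᴴ * L))) :
    (ρmix * D ρmix).trace = 0 ∧
    ∀ γ : ℝ, 0 < γ →
      ¬ ∃ H : Matrix (Fin 2) (Fin 2) ℂ, H.IsHermitian ∧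
          (-Complex.I) • (H * ρmix - ρmix * H) + (γ : ℂ) • D ρmix = 0 := by
  have hDρ : D ρmix = !![1/2, 0; 0, -1/2] := by
    rw [hD, hρ, hL]
    ext i j
    fin_cases i <;> fin_cases j <;>
      norm_num [Matrix.mul_apply, Fin.sum_univ_two, Matrix.one_apply, Matrix.vecMul, dotProduct]
  refine ⟨?_, ?_⟩
  · rw [hDρ, hρ]
    norm_num [Matrix.trace_fin_two]
  · rintro γ hγ ⟨H, -, hH⟩
    have hcomm : H * ρmix - ρmix * H = 0 := by simp [hρ]
    rw [hcomm, smul_zero, zero_add, hDρ] at hH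
    have h00 := congrFun (congrFun hH 0) 0
    simp [hγ.ne'] at h00
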